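/- Fix D = {d_1 < … < d_k} ⊆ [n−1] with d_0 = 0, d_{k+1} = n and I = [n−1] ∖ D; let c ∈ S_n be a standard Coxeter element of some parabolic subgroup with ℓ(w_0(I)c) = ℓ(w_0(I)) + ℓ(c) and I ⊆ J(w_0(I)c); let λ be a partition with at most n parts and γ ∈ Par_D. Let i < p < j < q all lie in the same block and β ∈ P_{cλ,γ}. If both (i,j) and (p,q) are interweaved for cλ, β_i > β_j − (j−i), and β_p > β_q − (q−p), then t_{ij}β ∉ P_{cλ,γ} or t_{pq}β ∉ P_{cλ,γ}. -/

import Mathlib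

open scoped Classical

namespace LSS

noncomputable section

open MvPolynomial

/-- The simple transposition `s_i ∈ S_n` (`1 ≤ i ≤ n-1`, 1-indexed): it exchanges the
letters `i` and `i+1` of `[n] = {1, …, n}`, realized on `Fin n` (0-indexed) as the swap
of `i-1` and `i`. For `i` out of range it is the identity. -/
def st (n : ℕ) (i : ℕ) : Equiv.Perm (Fin n) :=
  if h : 0 < i ∧ i < n then Equiv.swap ⟨i - 1, by omega⟩ ⟨i, h.2⟩ else 1

/-- Coxeter length of `w ∈ S_n` = number of inversions. -/
def len (n : ℕ) (w : Equiv.Perm (Fin n)) : ℕ :=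
  (Finset.univ.filter fun p : Fin n × Fin n => p.1 < p.2 ∧ w p.2 < w p.1).card

/-- `L` is a reduced word for `w`: a list of indices in `[n-1]` of length `ℓ(w)` whose
associated product of simple transpositions is `w`. -/
def IsRedWord (n : ℕ) (L : List ℕ) (w : Equiv.Perm (Fin n)) : Prop :=
  (∀ i ∈ L, 1 ≤ i ∧ i ≤ n - 1) ∧ (L.map (st n)).prod = w ∧ L.length = len n w

/-- The left descent set `J(w) = {j ∈ [n-1] : ℓ(s_j w) < ℓ(w)}`. -/
def Descents (n : ℕ) (w : Equiv.Perm (Fin n)) : Set ℕ :=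
  {j | 1 ≤ j ∧ j ≤ n - 1 ∧ len n (st n j * w) < len n w}

/-- The parabolic subgroup of `S_n` generated by `{s_i : i ∈ I}`. -/
def parab (n : ℕ) (I : Set ℕ) : Subgroup (Equiv.Perm (Fin n)) :=
  Subgroup.closure (st n '' I)

/-- `u = w_0(I)`, the longest element of the parabolic subgroup generated by `{s_i : i ∈ I}`. -/
def IsLongest (n : ℕ) (I : Set ℕ) (u : Equiv.Perm (Fin n)) : Prop :=
  u ∈ parab n I ∧ ∀ v ∈ parab n I, len n v ≤ len n u

/-- `c` is a standard Coxeter element of some parabolic subgroup of `S_n`: a product of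
the elements of some subset of `{s_1, …, s_{n-1}}`, each appearing exactly once, in some order. -/
def IsStdCox (n : ℕ) (c : Equiv.Perm (Fin n)) : Prop :=
  ∃ L : List ℕ, L.Nodup ∧ (∀ i ∈ L, 1 ≤ i ∧ i ≤ n - 1) ∧ (L.map (st n)).prod = c

/-- A weak composition `β : Fin n → ℕ` as an exponent vector. -/
def expOf (n : ℕ) (β : Fin n → ℕ) : Fin n →₀ ℕ := Finsupp.equivFunOnFinite.symm β

/-- The monomial `x^β = x_1^{β_1} ⋯ x_n^{β_n}`. -/
def mono (n : ℕ) (β : Fin n → ℕ) : MvPolynomial (Fin n) ℤ := monomial (expOf n β) 1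

/-- The coefficient `[x^β] f`. -/
def coeffOf (n : ℕ) (β : Fin n → ℕ) (f : MvPolynomial (Fin n) ℤ) : ℤ := coeff (expOf n β) f

/-- The isobaric divided difference (Demazure) operator
`π_i(f) = (x_i f − x_{i+1} s_i f)/(x_i − x_{i+1})` (1-indexed `i`), defined as the unique
polynomial `g` with `(x_i − x_{i+1})·g = x_i f − x_{i+1} s_i f`; such a `g` always exists
and is unique since `ℤ[x_1,…,x_n]` is a domain. -/
def dem (n : ℕ) (i : ℕ) (f : MvPolynomial (Fin n) ℤ) : MvPolynomial (Fin n) ℤ :=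
  if h : 0 < i ∧ i < n then
    if hg : ∃ g, (X (⟨i - 1, by omega⟩ : Fin n) - X (⟨i, h.2⟩ : Fin n)) * g =
        X (⟨i - 1, by omega⟩ : Fin n) * f -
          X (⟨i, h.2⟩ : Fin n) *
            rename (⇑(Equiv.swap (⟨i - 1, by omega⟩ : Fin n) (⟨i, h.2⟩ : Fin n))) f then
      hg.choose
    else 0
  else f

/-- `π_{i_1} π_{i_2} ⋯ π_{i_ℓ} (f)` for a word `L = [i_1, …, i_ℓ]`. -/
def demWord (n : ℕ) (L : List ℕ) (f : MvPolynomial (Fin n) ℤ) : MvPolynomial (Fin n) ℤ :=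
  L.foldr (dem n) f

/-- Entry accessor for a composition, 0-indexed position, default `0` out of range. -/
def ent (n : ℕ) (α : Fin n → ℕ) (p : ℕ) : ℕ := if h : p < n then α ⟨p, h⟩ else 0

/-- Exchange the entries of `α` in (0-indexed) positions `p` and `p+1`. -/
def swapAt (n : ℕ) (p : ℕ) (α : Fin n → ℕ) : Fin n → ℕ := fun m =>
  if (m : ℕ) = p then ent n α (p + 1) else if (m : ℕ) = p + 1 then ent n α p else α m

/-- Auxiliary fuelled recursion computing the key polynomial `κ_α`:
if `α` is weakly decreasing, `κ_α = x^α`; otherwise, choosing an ascent `α_p < α_{p+1}`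
(0-indexed `p`), `κ_α = π_{p+1}(κ_{α̂})` where `α̂` swaps the two entries.  The fuel
`n*n` in `keyPoly` strictly exceeds the number of co-inversions, which drops by one at
each step, so the recursion always terminates at a weakly decreasing composition. -/
def keyAux (n : ℕ) : ℕ → (Fin n → ℕ) → MvPolynomial (Fin n) ℤ
  | 0, α => mono n α
  | k + 1, α =>
    if h : ∃ p : Fin n, ent n α p.1 < ent n α (p.1 + 1) then
      dem n (h.choose.1 + 1) (keyAux n k (swapAt n h.choose.1 α))
    else mono n α

/-- The key polynomial `κ_α`. -/
def keyPoly (n : ℕ) (α : Fin n → ℕ) : MvPolynomial (Fin n) ℤ := keyAux n (n * n) α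

/-- `wλ`, the composition `(λ_{w⁻¹(1)}, …, λ_{w⁻¹(n)})`. -/
def pact (n : ℕ) (w : Equiv.Perm (Fin n)) (lam : Fin n → ℕ) : Fin n → ℕ :=
  fun i => lam (w⁻¹ i)

/-- `lam` is a partition (weakly decreasing vector) with at most `n` parts. -/
def IsPartition (n : ℕ) (lam : Fin n → ℕ) : Prop := ∀ i j : Fin n, i ≤ j → lam j ≤ lam i

/-- Box `(c, r)` (column, row; both 1-indexed) belongs to the skyline diagram `D(α)`. -/
def InDiag (n : ℕ) (α : Fin n → ℕ) (c r : ℕ) : Prop :=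
  1 ≤ c ∧ c ≤ n ∧ 1 ≤ r ∧ r ≤ ent n α (c - 1)

/-- `F` (value of box (column, row)) is a filling of `D(α)` that is flagged (labels in
column `c` are in `{1, …, c}`) and row distinct. -/
def IsTab (n : ℕ) (α : Fin n → ℕ) (F : ℕ → ℕ → ℕ) : Prop :=
  (∀ c r, InDiag n α c r → 1 ≤ F c r ∧ F c r ≤ c) ∧
  ∀ c c' r, InDiag n α c r → InDiag n α c' r → c ≠ c' → F c r ≠ F c' r

/-- The weight of a filling: `wt(F)_i` = number of occurrences of the label `i`
(1-indexed; `Fin` position `i` records the label `i+1`). -/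
def wt (n : ℕ) (α : Fin n → ℕ) (F : ℕ → ℕ → ℕ) : Fin n → ℕ := fun i =>
  ((Finset.Icc 1 n ×ˢ Finset.Icc 1 (Finset.univ.sup α)).filter fun p =>
    InDiag n α p.1 p.2 ∧ F p.1 p.2 = i.1 + 1).card

/-- `leftmin_α(i) = min{α_j : j ≤ i}`. -/
def leftmin (n : ℕ) (α : Fin n → ℕ) (i : Fin n) : ℕ := sInf (α '' {j | j ≤ i})

/-- `rightmax_α(i) = max{α_j : j ≥ i}`. -/
def rightmax (n : ℕ) (α : Fin n → ℕ) (i : Fin n) : ℕ :=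
  Finset.sup (Finset.univ.filter fun j => i ≤ j) α

/-- `d` records `0 = d_0 < d_1 < ⋯ < d_k < d_{k+1} = n`. -/
def BlockData (n k : ℕ) (d : Fin (k + 2) → ℕ) : Prop :=
  d 0 = 0 ∧ d (Fin.last (k + 1)) = n ∧ StrictMono d

/-- `D = {d_1, …, d_k}` as a set of natural numbers. -/
def Dset (k : ℕ) (d : Fin (k + 2) → ℕ) : Set ℕ :=
  {m | ∃ t : Fin (k + 2), t ≠ 0 ∧ t ≠ Fin.last (k + 1) ∧ d t = m}

/-- `I = [n−1] ∖ D`. -/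
def Iset (n k : ℕ) (d : Fin (k + 2) → ℕ) : Set ℕ :=
  {m | 1 ≤ m ∧ m ≤ n - 1 ∧ m ∉ Dset k d}

/-- Positions `i, j` (of `Fin n`, 0-indexed; 1-indexed letters `i+1, j+1`) lie in the same
block: some `t` has `d_t < i+1, j+1 ≤ d_{t+1}`. -/
def SameBlock (n k : ℕ) (d : Fin (k + 2) → ℕ) (i j : Fin n) : Prop :=
  ∃ t : Fin (k + 1), d t.castSucc ≤ i.1 ∧ i.1 < d t.succ ∧ d t.castSucc ≤ j.1 ∧ j.1 < d t.succ

/-- The variables `X_t = {x_{d_t + 1}, …, x_{d_{t+1}}}` of the `t`-th block. -/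
def blockVars (n k : ℕ) (d : Fin (k + 2) → ℕ) (t : Fin (k + 1)) : Finset (Fin n) :=
  Finset.univ.filter fun p => d t.castSucc ≤ p.1 ∧ p.1 < d t.succ

/-- Complete homogeneous symmetric polynomial of degree `m` in the variables `S`. -/
def hPoly (n : ℕ) (S : Finset (Fin n)) (m : ℕ) : MvPolynomial (Fin n) ℤ :=
  ∑ f ∈ S.sym m, ((f : Multiset (Fin n)).map X).prod

/-- `h_z` for `z : ℤ`, with `h_z = 0` for `z < 0`. -/
def hZ (n : ℕ) (S : Finset (Fin n)) (z : ℤ) : MvPolynomial (Fin n) ℤ :=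
  if 0 ≤ z then hPoly n S z.toNat else 0

/-- The Schur polynomial `s_lam` in the variable set `S`, for a partition `lam`
(1-indexed parts, at most `t` of them), via the Jacobi–Trudi determinant
`det(h_{lam_i − i + j})_{1 ≤ i,j ≤ t}`. -/
def schurP (n : ℕ) (S : Finset (Fin n)) (t : ℕ) (lam : ℕ → ℕ) : MvPolynomial (Fin n) ℤ :=
  (Matrix.of fun i j : Fin t =>
    hZ n S ((lam (i.1 + 1) : ℤ) - (i.1 + 1) + (j.1 + 1))).det

/-- `γ ∈ Par_D`: a `(k+1)`-tuple of partitions, the `t`-th having at most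
`d_{t+1} − d_t` nonzero parts (1-indexed parts; the unused index `0` is normalized to `0`). -/
def ParD (k : ℕ) (d : Fin (k + 2) → ℕ) (γ : Fin (k + 1) → ℕ → ℕ) : Prop :=
  ∀ t : Fin (k + 1), γ t 0 = 0 ∧ (∀ a b : ℕ, 1 ≤ a → a ≤ b → γ t b ≤ γ t a) ∧
    ∀ m : ℕ, d t.succ - d t.castSucc < m → γ t m = 0

/-- The `D`-Schur polynomial `s_{γ^1,…,γ^{k+1}} = ∏_t s_{γ^t}(X_t)`. -/
def dSchur (n k : ℕ) (d : Fin (k + 2) → ℕ) (γ : Fin (k + 1) → ℕ → ℕ) :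
    MvPolynomial (Fin n) ℤ :=
  ∏ t : Fin (k + 1), schurP n (blockVars n k d t) (d t.succ - d t.castSucc) (γ t)

/-- Truncation of an integer vector to a natural-number vector. -/
def toNatV (n : ℕ) (β : Fin n → ℤ) : Fin n → ℕ := fun i => (β i).toNat

/-- `j − i` as an integer. -/
def gapZ (n : ℕ) (i j : Fin n) : ℤ := (j.1 : ℤ) - (i.1 : ℤ)

/-- The move `t_{ij}`: replace `β_i` by `β_j − (j−i)` and `β_j` by `β_i + (j−i)`. -/
def tmv (n : ℕ) (i j : Fin n) (β : Fin n → ℤ) : Fin n → ℤ := fun m =>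
  if m = i then β j - gapZ n i j else if m = j then β i + gapZ n i j else β m

/-- The rank `θ(β) = #{(a,b) : a < b in the same block and β_a < β_b − (b−a)}`. -/
def theta (n k : ℕ) (d : Fin (k + 2) → ℕ) (β : Fin n → ℤ) : ℕ :=
  (Finset.univ.filter fun p : Fin n × Fin n =>
    p.1 < p.2 ∧ SameBlock n k d p.1 p.2 ∧ β p.1 < β p.2 - gapZ n p.1 p.2).card

/-- One step up in the Bruhat-type order: `β ⋖ t_{ij} β` whenever `i < j` are in the same
block and `β_i > β_j − (j−i)`. -/
def stepUp (n k : ℕ) (d : Fin (k + 2) → ℕ) (β β' : Fin n → ℤ) : Prop :=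
  ∃ i j : Fin n, i < j ∧ SameBlock n k d i j ∧ β j - gapZ n i j < β i ∧ β' = tmv n i j β

/-- The order on compositions: transitive (reflexive) closure of `stepUp`. -/
def leB (n k : ℕ) (d : Fin (k + 2) → ℕ) : (Fin n → ℤ) → (Fin n → ℤ) → Prop :=
  Relation.ReflTransGen (stepUp n k d)

/-- Membership in the poset `P_{α,γ}` (for `α = cλ`): `β` is a weak composition with
`[x^β] κ_α ≠ 0` and `π_{w_0(I)}(x^β) = ± s_γ`. -/
def memP (n k : ℕ) (d : Fin (k + 2) → ℕ) (w0I : Equiv.Perm (Fin n)) (α : Fin n → ℕ)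
    (γ : Fin (k + 1) → ℕ → ℕ) (β : Fin n → ℤ) : Prop :=
  (∀ i, 0 ≤ β i) ∧ coeffOf n (toNatV n β) (keyPoly n α) ≠ 0 ∧
  ∃ L, IsRedWord n L w0I ∧
    (demWord n L (mono n (toNatV n β)) = dSchur n k d γ ∨
     demWord n L (mono n (toNatV n β)) = -dSchur n k d γ)

/-- The pair `i < j` is interweaved for `α`: `α_m ≥ α_{m+1}` for `i ≤ m < j`,
`leftmin_α(i) < α_i` and `rightmax_α(j) > α_j`. -/
def Interweaved (n : ℕ) (α : Fin n → ℕ) (i j : Fin n) : Prop :=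
  i < j ∧ (∀ p : Fin n, i ≤ p → p < j → ent n α (p.1 + 1) ≤ α p) ∧
  leftmin n α i < α i ∧ α j < rightmax n α j

/-- `center_α(i,j) = max{m : i ≤ m ≤ j and α_m ≥ rightmax_α(j)}` (as a 0-indexed position). -/
def center (n : ℕ) (α : Fin n → ℕ) (i j : Fin n) : ℕ :=
  Finset.sup (Finset.univ.filter fun p : Fin n => i ≤ p ∧ p ≤ j ∧ rightmax n α j ≤ α p)
    fun p => p.1

/-- Partial sum `β_1 + ⋯ + β_{m+1}` (0-indexed positions `≤ m`) of an integer vector. -/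
def psumZ (n : ℕ) (β : Fin n → ℤ) (m : ℕ) : ℤ :=
  ∑ p ∈ Finset.univ.filter (fun p : Fin n => p.1 ≤ m), β p

/-- Partial sum of a composition, as an integer. -/
def psumN (n : ℕ) (α : Fin n → ℕ) (m : ℕ) : ℤ :=
  ∑ p ∈ Finset.univ.filter (fun p : Fin n => p.1 ≤ m), (α p : ℤ)

/-- Composition pattern containment. -/
def ContainsPat (n : ℕ) {m : ℕ} (α : Fin n → ℕ) (pat : Fin m → ℕ) : Prop :=
  ∃ g : Fin m → Fin n, StrictMono g ∧
    (∀ s t : Fin m, pat s ≤ pat t ↔ α (g s) ≤ α (g t)) ∧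
    ∀ s t : Fin m, |(pat s : ℤ) - (pat t : ℤ)| ≤ |(α (g s) : ℤ) - (α (g t) : ℤ)|

end

end LSS
namespace LSS

section Helpers

/-- prefix sums -/
def FF {n : ℕ} (s : Fin n → ℕ) (m : ℕ) : ℕ := ∑ x, if x.1 < m then s x else 0

theorem FF_succ {n : ℕ} (s : Fin n → ℕ) (i : Fin n) : FF s (i.1 + 1) = FF s i.1 + s i := by
  unfold FF
  have h : ∀ x : Fin n, (if x.1 < i.1 + 1 then s x else 0) =
      (if x.1 < i.1 then s x else 0) + (if x = i then s i else 0) := by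
    intro x
    by_cases hx : x = i
    · subst hx; simp
    · have : x.1 ≠ i.1 := fun h => hx (Fin.ext h)
      simp only [hx, if_false, add_zero]
      congr 1
      apply propext; omega
  rw [Finset.sum_congr rfl (fun x _ => h x), Finset.sum_add_distrib]
  simp

theorem FF_swap {n : ℕ} (s : Fin n → ℕ) (i j : Fin n) (hij : j.1 = i.1 + 1) (m : ℕ)
    (hm : m ≠ i.1 + 1) : FF (fun x => s (Equiv.swap i j x)) m = FF s m := by
  unfold FF
  rw [← Equiv.sum_comp (Equiv.swap i j) (fun x => if x.1 < m then s x else 0)]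
  apply Finset.sum_congr rfl
  intro x _
  have : (x.1 < m) ↔ ((Equiv.swap i j x).1 < m) := by
    rw [Equiv.swap_apply_def]
    split_ifs with h1 h2
    · subst h1; omega
    · subst h2; omega
    · rfl
  simp only [this]

theorem row_step {n : ℕ} (A s : Fin n → ℕ) (i j : Fin n) (hij : j.1 = i.1 + 1)
    (hs : ∀ x, s x ≤ 1) (hA : A i ≤ A j) (hA1 : A j ≤ 1)
    (h : ∀ m, FF (fun x => A (Equiv.swap i j x)) m ≤ FF s m) :
    (∀ m, FF A m ≤ FF s m) ∧ (∀ m, FF A m ≤ FF (fun x => s (Equiv.swap i j x)) m) := by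
  have e0 := h i.1
  have e1 := h (i.1 + 1)
  have e2 := h (j.1 + 1)
  rw [FF_swap A i j hij _ (by omega)] at e0 e2
  rw [FF_succ, FF_swap A i j hij _ (by omega), FF_succ] at e1
  rw [FF_succ, FF_succ, hij, FF_succ, FF_succ] at e2
  simp only [Equiv.swap_apply_left] at e1
  have s1 := hs i
  have s2 := hs j
  constructor
  · intro m
    by_cases hm : m = i.1 + 1
    · subst hm; rw [FF_succ, FF_succ]; omega
    · rw [← FF_swap A i j hij m hm]; exact h m
  · intro m
    by_cases hm : m = i.1 + 1
    · subst hm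
      rw [FF_succ, FF_succ, FF_swap s i j hij _ (by omega)]
      simp only [Equiv.swap_apply_left]
      omega
    · rw [← FF_swap A i j hij m hm, FF_swap s i j hij m hm]; exact h m

/-- row indicator of the diagram of `α` -/
def rowA {n : ℕ} (α : Fin n → ℕ) (r : ℕ) (x : Fin n) : ℕ := if r < α x then 1 else 0

/-- `β` is a sum of indicator vectors dominated, row by row, by those of `α`. -/
def RowP {n : ℕ} (N : ℕ) (α β : Fin n → ℕ) : Prop :=
  ∃ S : ℕ → Fin n → ℕ, (∀ r x, S r x ≤ 1) ∧ (∀ r m, FF (rowA α r) m ≤ FF (S r) m) ∧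
    (∀ r, ∑ x, S r x = ∑ x, rowA α r x) ∧ ∀ x, β x = ∑ r ∈ Finset.range N, S r x

theorem sum_rowA {n : ℕ} (N : ℕ) (α : Fin n → ℕ) (x : Fin n) (h : α x ≤ N) :
    ∑ r ∈ Finset.range N, rowA α r x = α x := by
  unfold rowA
  rw [← Finset.card_filter]
  have : (Finset.range N).filter (fun r => r < α x) = Finset.range (α x) := by
    ext r; simp; omega
  rw [this, Finset.card_range]

theorem RowP_refl {n : ℕ} (N : ℕ) (α : Fin n → ℕ) (h : ∀ x, α x ≤ N) : RowP N α α := by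
  refine ⟨rowA α, ?_, fun _ _ => le_rfl, fun _ => rfl, fun x => (sum_rowA N α x (h x)).symm⟩
  intro r x; unfold rowA; split_ifs <;> simp

theorem choose_rows (N : ℕ) (f g : ℕ → ℕ) (hf : ∀ r, f r ≤ 1) (b : ℕ)
    (h1 : b ≤ ∑ r ∈ Finset.range N, f r)
    (h2 : min (∑ r ∈ Finset.range N, f r) (∑ r ∈ Finset.range N, g r) ≤ b) :
    ∃ K : Finset ℕ, ∑ r ∈ Finset.range N, (if r ∈ K then g r else f r) = b := by
  set R := (Finset.range N).filter (fun r => f r = 1 ∧ g r = 0) with hR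
  have hle : ∑ r ∈ Finset.range N, f r ≤ ∑ r ∈ Finset.range N, g r + R.card := by
    rw [hR, Finset.card_filter, ← Finset.sum_add_distrib]
    apply Finset.sum_le_sum
    intro r _
    have := hf r
    split_ifs with h <;> omega
  obtain ⟨K, hK, hc⟩ := Finset.exists_subset_card_eq
    (show (∑ r ∈ Finset.range N, f r) - b ≤ R.card by omega)
  refine ⟨K, ?_⟩
  have hs : ∑ r ∈ Finset.range N, (if r ∈ K then g r else f r) +
      ∑ r ∈ Finset.range N, (if r ∈ K then 1 else 0) = ∑ r ∈ Finset.range N, f r := by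
    rw [← Finset.sum_add_distrib]
    apply Finset.sum_congr rfl
    intro r _
    split_ifs with h
    · have := hK h
      simp only [hR, Finset.mem_filter] at this
      omega
    · simp
  have hcard : ∑ r ∈ Finset.range N, (if r ∈ K then 1 else 0) = K.card := by
    rw [← Finset.card_filter]
    congr 1
    ext r
    simp only [Finset.mem_filter]
    constructor
    · exact fun h => h.2
    · intro h
      have := hK h
      simp only [hR, Finset.mem_filter] at this
      exact ⟨this.1, h⟩
  omega

theorem RowP_step {n : ℕ} (N : ℕ) (α α' β β' : Fin n → ℕ) (i j : Fin n) (hij : j.1 = i.1 + 1)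
    (hα : α i < α j) (hα' : ∀ x, α' x = α (Equiv.swap i j x)) (h : RowP N α' β)
    (hoff : ∀ x, x ≠ i → x ≠ j → β' x = β x) (hsum : β' i + β' j = β i + β j)
    (hmin : min (β i) (β j) ≤ β' i) (hmax : β' i ≤ max (β i) (β j)) : RowP N α β' := by
  obtain ⟨S, hS1, hS2, hS3, hS4⟩ := h
  have hne : i ≠ j := by intro h; rw [h] at hij; omega
  have hrow : ∀ r, rowA α' r = fun x => rowA α r (Equiv.swap i j x) := by
    intro r; funext x; simp only [rowA, hα']
  have hK : ∃ K : Finset ℕ,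
      ∑ r ∈ Finset.range N, (if r ∈ K then S r j else S r i) = β' i ∧
      ∑ r ∈ Finset.range N, (if r ∈ K then S r i else S r j) = β' j := by
    have htot : ∀ K : Finset ℕ, ∑ r ∈ Finset.range N, (if r ∈ K then S r j else S r i) +
      ∑ r ∈ Finset.range N, (if r ∈ K then S r i else S r j) = β i + β j := by
      intro K
      rw [hS4, hS4, ← Finset.sum_add_distrib, ← Finset.sum_add_distrib]
      apply Finset.sum_congr rfl
      intro r _
      split_ifs <;> omega
    by_cases hc : β' i ≤ β i
    · obtain ⟨K, hK⟩ := choose_rows N (fun r => S r i) (fun r => S r j) (fun r => hS1 r i) (β' i)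
        (by rw [← hS4]; exact hc) (by rw [← hS4, ← hS4]; exact hmin)
      have := htot K
      exact ⟨K, hK, by omega⟩
    · obtain ⟨K, hK⟩ := choose_rows N (fun r => S r j) (fun r => S r i) (fun r => hS1 r j) (β' j)
        (by rw [← hS4]; omega) (by rw [← hS4, ← hS4]; omega)
      have := htot K
      exact ⟨K, by omega, hK⟩
  obtain ⟨K, hK1, hK2⟩ := hK
  refine ⟨fun r => if r ∈ K then (fun x => S r (Equiv.swap i j x)) else S r, ?_, ?_, ?_, ?_⟩
  · intro r x
    dsimp only
    split_ifs
    · exact hS1 _ _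
    · exact hS1 _ _
  · intro r m
    have hst := row_step (rowA α r) (S r) i j hij (hS1 r)
      (by unfold rowA; split_ifs <;> omega) (by unfold rowA; split_ifs <;> omega)
      (by rw [← hrow]; exact hS2 r)
    dsimp only
    split_ifs
    · exact hst.2 m
    · exact hst.1 m
  · intro r
    have h1 : ∑ x, rowA α' r x = ∑ x, rowA α r x := by
      rw [hrow]; exact Equiv.sum_comp (Equiv.swap i j) (rowA α r)
    dsimp only
    split_ifs
    · rw [Equiv.sum_comp (Equiv.swap i j) (S r), hS3, h1]
    · rw [hS3, h1]
  · intro x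
    by_cases hxi : x = i
    · subst hxi
      rw [← hK1]
      apply Finset.sum_congr rfl
      intro r _
      dsimp only
      split_ifs <;> simp
    · by_cases hxj : x = j
      · subst hxj
        rw [← hK2]
        apply Finset.sum_congr rfl
        intro r _
        dsimp only
        split_ifs <;> simp
      · rw [hoff x hxi hxj, hS4]
        apply Finset.sum_congr rfl
        intro r _
        dsimp only
        split_ifs
        · dsimp only; rw [Equiv.swap_apply_of_ne_of_ne hxi hxj]
        · rfl

theorem RowP_prefix {n : ℕ} (N : ℕ) (α β : Fin n → ℕ) (hN : ∀ x, α x ≤ N) (h : RowP N α β)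
    (m : ℕ) : FF α m ≤ FF β m := by
  obtain ⟨S, hS1, hS2, hS3, hS4⟩ := h
  have key : ∀ T : ℕ → Fin n → ℕ, FF (fun x => ∑ r ∈ Finset.range N, T r x) m =
      ∑ r ∈ Finset.range N, FF (T r) m := by
    intro T
    unfold FF
    rw [Finset.sum_comm]
    apply Finset.sum_congr rfl
    intro x _
    split_ifs <;> simp
  have e1 : α = fun x => ∑ r ∈ Finset.range N, rowA α r x := by
    funext x; exact (sum_rowA N α x (hN x)).symm
  have e2 : β = fun x => ∑ r ∈ Finset.range N, S r x := funext hS4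
  rw [e2, key]
  conv_lhs => rw [e1]
  rw [key]
  exact Finset.sum_le_sum fun r _ => hS2 r m

theorem RowP_dom {n : ℕ} (N : ℕ) (lam β : Fin n → ℕ) (w : Equiv.Perm (Fin n))
    (hlam : IsPartition n lam) (hN : ∀ x, lam x ≤ N)
    (h : RowP N (fun x => lam (w x)) β) (T : Finset (Fin n)) :
    ∑ x ∈ T, β x ≤ FF lam T.card := by
  obtain ⟨S, hS1, hS2, hS3, hS4⟩ := h
  have key : FF lam T.card = ∑ r ∈ Finset.range N, FF (rowA lam r) T.card := by
    unfold FF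
    rw [Finset.sum_comm]
    apply Finset.sum_congr rfl
    intro x _
    split_ifs
    · exact (sum_rowA N lam x (hN x)).symm
    · simp
  rw [key, Finset.sum_congr rfl (fun x _ => hS4 x), Finset.sum_comm]
  apply Finset.sum_le_sum
  intro r _
  by_cases hc : ∃ x : Fin n, x.1 < T.card ∧ lam x ≤ r
  · obtain ⟨x0, hx0, hx0'⟩ := hc
    calc ∑ x ∈ T, S r x ≤ ∑ x, S r x :=
          Finset.sum_le_sum_of_subset (Finset.subset_univ T)
      _ = ∑ x, rowA (fun x => lam (w x)) r x := hS3 r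
      _ = ∑ x, rowA lam r x := Equiv.sum_comp w (rowA lam r)
      _ ≤ FF (rowA lam r) T.card := by
        unfold FF
        apply Finset.sum_le_sum
        intro x _
        split_ifs with hx
        · exact le_rfl
        · have := hlam x0 x (by rw [Fin.le_def]; omega)
          unfold rowA
          rw [if_neg (by omega)]
  · push Not at hc
    calc ∑ x ∈ T, S r x ≤ ∑ x ∈ T, 1 := Finset.sum_le_sum fun x _ => hS1 r x
      _ = T.card := by simp
      _ ≤ FF (rowA lam r) T.card := by
        unfold FF
        have hT : T.card ≤ n := by simpa using Finset.card_le_univ T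
        have : ∀ x : Fin n, (if x.1 < T.card then rowA lam r x else 0) =
            if x.1 < T.card then 1 else 0 := by
          intro x
          split_ifs with hx
          · unfold rowA; rw [if_pos (hc x hx)]
          · rfl
        rw [Finset.sum_congr rfl (fun x _ => this x), ← Finset.card_filter]
        have h3 : ((Finset.univ : Finset (Fin n)).filter fun x => x.1 < T.card).card = T.card := by
          rw [Fin.card_filter_val_lt]; omega
        omega

end Helpers

section DemSupport

open MvPolynomial

theorem mono_quot {n : ℕ} (i j : Fin n) (hne : i ≠ j) (ρ : Fin n →₀ ℕ)
    (V : Set (Fin n →₀ ℕ))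
    (hV : ∀ ρ' : Fin n →₀ ℕ, (∀ x, x ≠ i → x ≠ j → ρ' x = ρ x) → ρ' i + ρ' j = ρ i + ρ j →
      min (ρ i) (ρ j) ≤ ρ' i → ρ' i ≤ max (ρ i) (ρ j) → ρ' ∈ V) :
    ∃ g ∈ restrictSupport ℤ V, (X i - X j) * g =
      X i * monomial ρ 1 - X j * rename (⇑(Equiv.swap i j)) (monomial ρ (1 : ℤ)) := by
  set ρ0 := (ρ.erase i).erase j with hρ0
  set e : ℕ → ℕ → (Fin n →₀ ℕ) := fun u v => ρ0 + Finsupp.single i u + Finsupp.single j v with he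
  have ei : ∀ u v, e u v i = u := by
    intro u v; simp [he, hρ0, hne, hne.symm]
  have ej : ∀ u v, e u v j = v := by
    intro u v; simp [he, hρ0, hne, hne.symm]
  have eo : ∀ u v x, x ≠ i → x ≠ j → e u v x = ρ x := by
    intro u v x h1 h2; simp [he, hρ0, h1, h2]
  have e1 : ρ = e (ρ i) (ρ j) := by
    ext x
    by_cases h1 : x = i
    · subst h1; rw [ei]
    · by_cases h2 : x = j
      · subst h2; rw [ej]
      · rw [eo _ _ _ h1 h2]
  have e2 : ρ.mapDomain (Equiv.swap i j) = e (ρ j) (ρ i) := by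
    ext x
    have hx : ρ.mapDomain (Equiv.swap i j) x = ρ (Equiv.swap i j x) := by
      conv_lhs => rw [← Equiv.swap_apply_self i j x]
      exact Finsupp.mapDomain_apply (Equiv.swap i j).injective _ _
    rw [hx]
    by_cases h1 : x = i
    · subst h1; rw [ei]; simp
    · by_cases h2 : x = j
      · subst h2; rw [ej]; simp
      · rw [eo _ _ _ h1 h2, Equiv.swap_apply_of_ne_of_ne h1 h2]
  have em : ∀ u v, monomial (e u v) (1 : ℤ) = monomial ρ0 1 * (X i ^ u * X j ^ v) := by
    intro u v
    rw [X_pow_eq_monomial, X_pow_eq_monomial, monomial_mul, monomial_mul, he]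
    simp [add_assoc]
  rw [rename_monomial, e2]
  conv => enter [1, g, 2, 2, 1]; rw [e1]
  rw [em, em]
  generalize ρ i = a at *
  generalize ρ j = b at *
  rcases le_or_gt b a with hab | hab
  · obtain ⟨t, rfl⟩ := Nat.exists_eq_add_of_le hab
    refine ⟨∑ k ∈ Finset.range (t + 1), monomial (e (b + k) (b + (t + 1 - 1 - k))) 1, ?_, ?_⟩
    · apply Submodule.sum_mem
      intro k hk
      rw [Finset.mem_range] at hk
      rw [monomial_mem_restrictSupport]
      left
      apply hV
      · intro x h1 h2; exact eo _ _ _ h1 h2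
      · rw [ei, ej]; omega
      · rw [ei]; omega
      · rw [ei]; omega
    · have hg := geom_sum₂_mul (X i : MvPolynomial (Fin n) ℤ) (X j) (t + 1)
      have : ∑ k ∈ Finset.range (t + 1), monomial (e (b + k) (b + (t + 1 - 1 - k))) (1 : ℤ) =
          monomial ρ0 1 * (X i ^ b * X j ^ b) *
            ∑ k ∈ Finset.range (t + 1), X i ^ k * X j ^ (t + 1 - 1 - k) := by
        rw [Finset.mul_sum]
        apply Finset.sum_congr rfl
        intro k _
        rw [em]; ring
      rw [this]
      linear_combination (monomial ρ0 1 * (X i ^ b * X j ^ b)) * hg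
  · obtain ⟨t, rfl⟩ := Nat.exists_eq_add_of_lt hab
    refine ⟨-∑ k ∈ Finset.range t, monomial (e (a + 1 + k) (a + 1 + (t - 1 - k))) 1, ?_, ?_⟩
    · apply Submodule.neg_mem
      apply Submodule.sum_mem
      intro k hk
      rw [Finset.mem_range] at hk
      rw [monomial_mem_restrictSupport]
      left
      apply hV
      · intro x h1 h2; exact eo _ _ _ h1 h2
      · rw [ei, ej]; omega
      · rw [ei]; omega
      · rw [ei]; omega
    · have hg := geom_sum₂_mul (X i : MvPolynomial (Fin n) ℤ) (X j) t
      have : ∑ k ∈ Finset.range t, monomial (e (a + 1 + k) (a + 1 + (t - 1 - k))) (1 : ℤ) =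
          monomial ρ0 1 * (X i ^ (a + 1) * X j ^ (a + 1)) *
            ∑ k ∈ Finset.range t, X i ^ k * X j ^ (t - 1 - k) := by
        rw [Finset.mul_sum]
        apply Finset.sum_congr rfl
        intro k _
        rw [em]; ring
      rw [this]
      linear_combination (-monomial ρ0 1 * (X i ^ (a + 1) * X j ^ (a + 1))) * hg

theorem dem_supp {n : ℕ} (i j : Fin n) (hij : j.1 = i.1 + 1) (U V : Set (Fin n →₀ ℕ))
    (hUV : ∀ ρ ∈ U, ∀ ρ' : Fin n →₀ ℕ, (∀ x, x ≠ i → x ≠ j → ρ' x = ρ x) →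
      ρ' i + ρ' j = ρ i + ρ j →
      min (ρ i) (ρ j) ≤ ρ' i → ρ' i ≤ max (ρ i) (ρ j) → ρ' ∈ V)
    (f : MvPolynomial (Fin n) ℤ) (hf : f ∈ restrictSupport ℤ U) :
    dem n (i.1 + 1) f ∈ restrictSupport ℤ V := by
  have hne : i ≠ j := by intro h; rw [h] at hij; omega
  have hex : ∃ g ∈ restrictSupport ℤ V, (X i - X j) * g =
      X i * f - X j * rename (⇑(Equiv.swap i j)) f := by
    have h1 : ∀ ρ : Fin n →₀ ℕ, ∃ g : MvPolynomial (Fin n) ℤ, ρ ∈ f.support →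
        g ∈ restrictSupport ℤ V ∧ (X i - X j) * g =
        X i * monomial ρ 1 - X j * rename (⇑(Equiv.swap i j)) (monomial ρ (1 : ℤ)) := by
      intro ρ
      by_cases hρ : ρ ∈ f.support
      · obtain ⟨g, hg1, hg2⟩ := mono_quot i j hne ρ V
          (hUV ρ ((mem_restrictSupport_iff ℤ).1 hf hρ))
        exact ⟨g, fun _ => ⟨hg1, hg2⟩⟩
      · exact ⟨0, fun h => absurd h hρ⟩
    choose G hG using h1
    refine ⟨∑ ρ ∈ f.support, C (coeff ρ f) * G ρ, ?_, ?_⟩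
    · apply Submodule.sum_mem
      intro ρ hρ
      rw [← smul_eq_C_mul]
      exact Submodule.smul_mem _ _ (hG ρ hρ).1
    · have hfs : f = ∑ ρ ∈ f.support, C (coeff ρ f) * monomial ρ 1 := by
        conv_lhs => rw [f.as_sum]
        apply Finset.sum_congr rfl
        intro ρ _
        rw [C_mul_monomial, mul_one]
      conv_rhs => rw [hfs]
      rw [map_sum, Finset.mul_sum, Finset.mul_sum, Finset.mul_sum, ← Finset.sum_sub_distrib]
      apply Finset.sum_congr rfl
      intro ρ hρ
      rw [map_mul, rename_C]
      linear_combination C (coeff ρ f) * (hG ρ hρ).2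
  obtain ⟨g, hgV, hg⟩ := hex
  have hj : (⟨i.1 + 1, hij ▸ j.2⟩ : Fin n) = j := Fin.ext hij.symm
  have hi : (⟨i.1 + 1 - 1, by omega⟩ : Fin n) = i := Fin.ext (by simp)
  have hcond : 0 < i.1 + 1 ∧ i.1 + 1 < n := ⟨by omega, hij ▸ j.2⟩
  unfold dem
  rw [dif_pos hcond]
  simp only [hi, hj]
  have hex : ∃ g, (X i - X j) * g = X i * f - X j * rename (⇑(Equiv.swap i j)) f := ⟨g, hg⟩
  rw [dif_pos hex]
  have hc := hex.choose_spec
  have hX : (X i - X j : MvPolynomial (Fin n) ℤ) ≠ 0 := by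
    rw [sub_ne_zero]
    intro h
    exact hne (X_injective h)
  have : hex.choose = g := mul_left_cancel₀ hX (hc.trans hg.symm)
  rw [this]
  exact hgV

theorem keyAux_supp {n : ℕ} (N : ℕ) : ∀ (m : ℕ) (α : Fin n → ℕ), (∀ x, α x ≤ N) →
    keyAux n m α ∈ restrictSupport ℤ {ρ : Fin n →₀ ℕ | RowP N α ρ} := by
  have base : ∀ α : Fin n → ℕ, (∀ x, α x ≤ N) →
      mono n α ∈ restrictSupport ℤ {ρ : Fin n →₀ ℕ | RowP N α ρ} := by
    intro α h
    unfold mono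
    rw [monomial_mem_restrictSupport]
    left
    exact RowP_refl N α h
  intro m
  induction m with
  | zero => intro α h; exact base α h
  | succ m ih =>
    intro α h
    unfold keyAux
    split_ifs with hp
    · have hs := hp.choose_spec
      set i := hp.choose with hi
      have hlt : i.1 + 1 < n := by
        by_contra hcon
        have h0 : ent n α (i.1 + 1) = 0 := by unfold ent; rw [dif_neg hcon]
        omega
      set j : Fin n := ⟨i.1 + 1, hlt⟩ with hj
      have hEi : ent n α i.1 = α i := by unfold ent; rw [dif_pos i.2]
      have hEj : ent n α (i.1 + 1) = α j := by unfold ent; rw [dif_pos hlt]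
      have hsw : ∀ x, swapAt n i.1 α x = α (Equiv.swap i j x) := by
        intro x
        unfold swapAt
        rw [hEi, hEj, Equiv.swap_apply_def]
        by_cases h1 : x = i
        · rw [if_pos h1, if_pos (by rw [h1])]
        · have h1' : x.1 ≠ i.1 := fun hh => h1 (Fin.ext hh)
          rw [if_neg h1, if_neg h1']
          by_cases h2 : x = j
          · rw [if_pos h2, if_pos (by rw [h2])]
          · have h2' : x.1 ≠ i.1 + 1 := fun hh => h2 (Fin.ext hh)
            rw [if_neg h2, if_neg h2']
      apply dem_supp i j rfl _ _ _ _ (ih (swapAt n i.1 α) ?_)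
      · intro ρ hρ ρ' a1 a2 a3 a4
        exact RowP_step N α (swapAt n i.1 α) ρ ρ' i j rfl (by rw [← hEi, ← hEj]; exact hs) hsw hρ
          a1 a2 a3 a4
      · intro x; rw [hsw]; exact h _
    · exact base α h

theorem coeff_RowP {n : ℕ} (N : ℕ) (α β : Fin n → ℕ) (h : ∀ x, α x ≤ N)
    (hc : coeffOf n β (keyPoly n α) ≠ 0) : RowP N α β := by
  have := (mem_restrictSupport_iff ℤ).1 (keyAux_supp N (n * n) α h)
    (show expOf n β ∈ (keyAux n (n * n) α).support from mem_support_iff.2 hc)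
  exact this

end DemSupport

section Cox

theorem st_prefix {n : ℕ} (a m : ℕ) (h : a ≠ m) (x : Fin n) :
    (st n a x).1 < m ↔ x.1 < m := by
  unfold st
  split_ifs with hh
  · rw [Equiv.swap_apply_def]
    split_ifs with h1 h2
    · subst h1; simp only; omega
    · subst h2; simp only; omega
    · rfl
  · rfl

theorem word_prefix {n : ℕ} (m : ℕ) (L : List ℕ) (h : m ∉ L) (x : Fin n) :
    ((L.map (st n)).prod x).1 < m ↔ x.1 < m := by
  induction L with
  | nil => simp
  | cons a L ih =>
    simp only [List.mem_cons, not_or] at h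
    rw [List.map_cons, List.prod_cons, Equiv.Perm.mul_apply, st_prefix a m (Ne.symm h.1), ih h.2]

theorem cox_inv {n : ℕ} (c : Equiv.Perm (Fin n)) (hc : IsStdCox n c) : IsStdCox n c⁻¹ := by
  obtain ⟨L, h1, h2, h3⟩ := hc
  refine ⟨L.reverse, List.nodup_reverse.2 h1, fun i hi => h2 i (List.mem_reverse.1 hi), ?_⟩
  rw [← h3, List.prod_inv_reverse, List.map_reverse, List.map_map]
  congr 2
  apply List.map_congr_left
  intro a _
  simp only [Function.comp]
  unfold st
  split_ifs
  · rw [Equiv.swap_inv]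
  · simp

/-- At most one element crosses upward at each level. -/
theorem cox_cross {n : ℕ} (c : Equiv.Perm (Fin n)) (hc : IsStdCox n c) (m : ℕ) (x y : Fin n)
    (hx : x.1 < m) (hy : y.1 < m) (hcx : m ≤ (c x).1) (hcy : m ≤ (c y).1) : x = y := by
  obtain ⟨L, h1, h2, h3⟩ := hc
  by_cases hm : m ∈ L
  · obtain ⟨u, v, rfl⟩ := List.append_of_mem hm
    have hu : m ∉ u := by
      intro h; rw [List.nodup_append] at h1; exact h1.2.2 m h m (by simp) rfl
    have hv : m ∉ v := by
      intro h; rw [List.nodup_append, List.nodup_cons] at h1; exact h1.2.1.1 h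
    rw [List.map_append, List.prod_append, List.map_cons, List.prod_cons] at h3
    have key : ∀ x : Fin n, x.1 < m → m ≤ (c x).1 → ((v.map (st n)).prod x).1 + 1 = m := by
      intro x hx hcx
      rw [← h3, Equiv.Perm.mul_apply, Equiv.Perm.mul_apply, ← not_lt, word_prefix m u hu] at hcx
      have hvx := (word_prefix m v hv x).2 hx
      generalize (v.map (st n)).prod x = t at *
      unfold st at hcx
      split_ifs at hcx with hh
      · rw [Equiv.swap_apply_def] at hcx
        split_ifs at hcx with g1 g2
        · rw [g1]; simp only; omega
        · rw [g2] at hvx; simp only at hvx; omega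
        · omega
      · exact absurd hvx hcx
    have k1 := key x hx hcx
    have k2 := key y hy hcy
    exact (v.map (st n)).prod.injective (Fin.ext (by omega))
  · have := (word_prefix m L hm x).2 hx
    rw [h3] at this
    omega

/-- No fixed point is jumped over. -/
theorem cox_fix {n : ℕ} (c : Equiv.Perm (Fin n)) (hc : IsStdCox n c) (z x : Fin n)
    (hz : c z = z) (hx : x.1 < z.1) (hcx : z.1 < (c x).1) : False := by
  obtain ⟨L, h1, h2, h3⟩ := hc
  have hm : z.1 + 1 ∈ L := by
    by_contra hm
    have := (word_prefix (z.1 + 1) L hm x).2 (by omega)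
    rw [h3] at this
    omega
  have hmn := h2 _ hm
  have hzn : z.1 + 1 < n := by omega
  obtain ⟨u, v, rfl⟩ := List.append_of_mem hm
  have hu : z.1 + 1 ∉ u := by
    intro h; rw [List.nodup_append] at h1; exact h1.2.2 _ h _ (by simp) rfl
  have hv : z.1 + 1 ∉ v := by
    intro h; rw [List.nodup_append, List.nodup_cons] at h1; exact h1.2.1.1 h
  have huv : z.1 ∈ u → z.1 ∉ v := by
    intro h h'; rw [List.nodup_append] at h1; exact h1.2.2 _ h _ (by simp [h']) rfl
  rw [List.map_append, List.prod_append, List.map_cons, List.prod_cons] at h3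
  rw [← h3, Equiv.Perm.mul_apply, Equiv.Perm.mul_apply] at hz
  have hvz := (word_prefix (z.1 + 1) v hv z).2 (by omega)
  have hvz2 : z.1 ∉ v → ¬ ((v.map (st n)).prod z).1 < z.1 := by
    intro h; rw [word_prefix z.1 v h]; omega
  generalize (v.map (st n)).prod z = t at *
  have hst : st n (z.1 + 1) = Equiv.swap z ⟨z.1 + 1, hzn⟩ := by
    unfold st; rw [dif_pos (by omega)]; congr 1
  rw [hst] at hz
  by_cases ht : t = z
  · rw [ht, Equiv.swap_apply_left] at hz
    have := word_prefix (z.1 + 1) u hu (⟨z.1 + 1, hzn⟩ : Fin n)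
    rw [hz] at this
    simp at this
  · have ht' : t.1 ≠ z.1 := fun h => ht (Fin.ext h)
    rw [Equiv.swap_apply_of_ne_of_ne ht (by intro h; rw [h] at hvz; simp at hvz)] at hz
    by_cases hzu : z.1 ∈ u
    · have := hvz2 (huv hzu); omega
    · have := word_prefix z.1 u hzu t
      rw [hz] at this
      omega

/-- The turning point between `p` and `j`. -/
theorem cox_center {n : ℕ} (c : Equiv.Perm (Fin n)) (hc : IsStdCox n c) (p j a b : Fin n)
    (hpj : p < j) (hap : a < p) (ha : c⁻¹ p < c⁻¹ a) (hjb : j < b) (hb : c⁻¹ b < c⁻¹ j) :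
    ∃ z : ℕ, p.1 ≤ z ∧ z < j.1 ∧ (∀ x : Fin n, x.1 ≤ z → (c⁻¹ x).1 ≤ z + 1) ∧
      (∀ y : Fin n, y.1 < z → (c y).1 ≤ z) := by
  have hw := cox_inv c hc
  simp only [Fin.lt_def] at *
  have hp : (c⁻¹ p).1 ≤ p.1 := by
    by_contra h
    have := cox_cross c⁻¹ hw (p.1 + 1) a p (by omega) (by omega) (by omega) (by omega)
    rw [this] at hap; omega
  have hj : j.1 ≤ (c⁻¹ j).1 := by
    by_contra h
    have := cox_cross c hc j.1 (c⁻¹ b) (c⁻¹ j) (by omega) (by omega) (by simp; omega) (by simp)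
    rw [this] at hb; omega
  have hz : ∃ z : ℕ, p.1 ≤ z ∧ z < j.1 ∧ (∃ h : z < n, (c⁻¹ ⟨z, h⟩).1 ≤ z) ∧
      (∃ h : z + 1 < n, z + 1 ≤ (c⁻¹ ⟨z + 1, h⟩).1) := by
    by_contra hcon
    push Not at hcon
    have : ∀ t : ℕ, p.1 + t ≤ j.1 - 1 → ∃ h : p.1 + t < n, (c⁻¹ ⟨p.1 + t, h⟩).1 ≤ p.1 + t := by
      intro t
      induction t with
      | zero => intro _; exact ⟨p.2, hp⟩
      | succ t ih =>
        intro ht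
        have h1 := hcon (p.1 + t) (by omega) (by omega) (ih (by omega)) (by omega)
        refine ⟨by omega, ?_⟩
        show (c⁻¹ ⟨p.1 + t + 1, _⟩).1 ≤ p.1 + t + 1
        omega
    have h2 := this (j.1 - 1 - p.1) (by omega)
    have h3 := hcon (p.1 + (j.1 - 1 - p.1)) (by omega) (by omega) h2 (by omega)
    have h4 : (⟨p.1 + (j.1 - 1 - p.1) + 1, by omega⟩ : Fin n) = j := Fin.ext (by simp; omega)
    rw [h4] at h3
    omega
  obtain ⟨z, hz1, hz2, ⟨hzn, hz3⟩, ⟨hzn', hz4⟩⟩ := hz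
  refine ⟨z, hz1, hz2, ?_, ?_⟩
  · intro x hx
    by_contra hcon
    set Z : Fin n := ⟨z + 1, hzn'⟩ with hZ
    have hZv : Z.1 = z + 1 := rfl
    have hcZ : c⁻¹ (c Z) = Z := by simp
    rcases lt_trichotomy (c Z).1 (z + 1) with h | h | h
    · have := cox_cross c⁻¹ hw (z + 1) x (c Z) (by omega) h (by omega) (by rw [hcZ])
      rw [this, hcZ] at hcon; omega
    · have h5 : c Z = Z := Fin.ext h
      have h6 : c⁻¹ Z = Z := by rw [Equiv.Perm.inv_eq_iff_eq]; exact h5.symm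
      exact cox_fix c⁻¹ hw Z x h6 (by omega) (by omega)
    · have h7 : (c⁻¹ Z).1 ≠ z + 1 := by
        intro h8
        have h9 : c⁻¹ Z = Z := Fin.ext h8
        rw [Equiv.Perm.inv_eq_iff_eq] at h9
        rw [← h9] at h; omega
      have := cox_cross c⁻¹ hw (z + 2) x Z (by omega) (by omega) (by omega) (by omega)
      rw [this] at hx; omega
  · intro y hy
    by_contra hcon
    set Z : Fin n := ⟨z, hzn⟩ with hZ
    have hZv : Z.1 = z := rfl
    rcases lt_trichotomy (c Z).1 z with h | h | h
    · have h7 : (c⁻¹ Z).1 ≠ z := by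
        intro h8
        have h9 : c⁻¹ Z = Z := Fin.ext h8
        rw [Equiv.Perm.inv_eq_iff_eq] at h9
        rw [← h9] at h; omega
      have := cox_cross c hc z y (c⁻¹ Z) (by omega) (by omega) (by omega) (by simp [hZv])
      rw [this] at hcon
      simp [hZv] at hcon
    · exact cox_fix c hc Z y (Fin.ext h) (by omega) (by omega)
    · have := cox_cross c hc (z + 1) y Z (by omega) (by omega) (by omega) (by omega)
      rw [this] at hy; omega

theorem prefix_bound {n : ℕ} (c : Equiv.Perm (Fin n)) (lam : Fin n → ℕ)
    (hlam : IsPartition n lam) (z : ℕ) (hz : z + 1 < n)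
    (h1 : ∀ x : Fin n, x.1 ≤ z → (c⁻¹ x).1 ≤ z + 1)
    (h2 : ∀ y : Fin n, y.1 < z → (c y).1 ≤ z) :
    FF lam z + lam ⟨z + 1, hz⟩ ≤ FF (fun x => lam (c⁻¹ x)) (z + 1) := by
  set W := (Finset.univ : Finset (Fin n)).filter (fun y => (c y).1 < z + 1) with hW
  set Q := (Finset.univ : Finset (Fin n)).filter (fun y => y.1 < z) with hQ
  have e1 : FF (fun x => lam (c⁻¹ x)) (z + 1) = ∑ y ∈ W, lam y := by
    unfold FF
    rw [hW, Finset.sum_filter,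
      ← Equiv.sum_comp c (fun x => if x.1 < z + 1 then lam (c⁻¹ x) else 0)]
    simp
  have e2 : FF lam z = ∑ y ∈ Q, lam y := by
    unfold FF; rw [hQ, Finset.sum_filter]
  have hQW : Q ⊆ W := by
    intro y hy
    simp only [hQ, hW, Finset.mem_filter, Finset.mem_univ, true_and] at *
    have := h2 y hy
    omega
  have cQ : Q.card = z := by rw [hQ, Fin.card_filter_val_lt]; omega
  have cW : W.card = z + 1 := by
    have : W = ((Finset.univ : Finset (Fin n)).filter (fun y => y.1 < z + 1)).map
        c⁻¹.toEmbedding := by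
      ext y
      simp only [hW, Finset.mem_filter, Finset.mem_univ, true_and, Finset.mem_map,
        Equiv.coe_toEmbedding]
      constructor
      · intro h; exact ⟨c y, h, by simp⟩
      · rintro ⟨x, hx, rfl⟩; simpa using hx
    rw [this, Finset.card_map, Fin.card_filter_val_lt]; omega
  have hd : (W \ Q).card = 1 := by rw [Finset.card_sdiff_of_subset hQW]; omega
  obtain ⟨v, hv⟩ := Finset.card_eq_one.1 hd
  have hvW : v ∈ W := (Finset.mem_sdiff.1 (hv ▸ Finset.mem_singleton_self v)).1
  have hv1 : v.1 ≤ z + 1 := by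
    simp only [hW, Finset.mem_filter, Finset.mem_univ, true_and] at hvW
    have := h1 (c v) (by omega)
    simpa using this
  have := Finset.sum_sdiff (f := lam) hQW
  rw [hv, Finset.sum_singleton] at this
  have := hlam v ⟨z + 1, hz⟩ hv1
  omega

end Cox

theorem main_aux {n : ℕ} (c : Equiv.Perm (Fin n)) (hc : IsStdCox n c)
    (lam : Fin n → ℕ) (hlam : IsPartition n lam)
    (β : Fin n → ℤ) (i p j q : Fin n) (h1 : i < p) (h2 : p < j) (h3 : j < q)
    (hlm : leftmin n (pact n c lam) p < pact n c lam p)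
    (hrm : pact n c lam j < rightmax n (pact n c lam) j)
    (hβ0 : ∀ x, 0 ≤ β x) (hβ : coeffOf n (toNatV n β) (keyPoly n (pact n c lam)) ≠ 0)
    (ha0 : ∀ x, 0 ≤ tmv n i j β x)
    (ha : coeffOf n (toNatV n (tmv n i j β)) (keyPoly n (pact n c lam)) ≠ 0)
    (hb0 : ∀ x, 0 ≤ tmv n p q β x)
    (hb : coeffOf n (toNatV n (tmv n p q β)) (keyPoly n (pact n c lam)) ≠ 0) : False := by
  set N := Finset.univ.sup lam with hN
  have hlN : ∀ x, lam x ≤ N := fun x => Finset.le_sup (Finset.mem_univ x)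
  have hαN : ∀ x, pact n c lam x ≤ N := fun x => hlN _
  have hanti : ∀ x y : Fin n, pact n c lam x < pact n c lam y → c⁻¹ y < c⁻¹ x := by
    intro x y h
    by_contra hcon
    have := hlam _ _ (not_lt.1 hcon)
    unfold pact at h
    omega
  -- the witnesses
  obtain ⟨a, hap, hcap⟩ : ∃ a : Fin n, a < p ∧ c⁻¹ p < c⁻¹ a := by
    have hmem := Nat.sInf_mem (s := pact n c lam '' {j | j ≤ p}) ⟨_, ⟨p, le_refl p, rfl⟩⟩
    obtain ⟨a, ha1, ha2⟩ := hmem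
    have hlt : pact n c lam a < pact n c lam p := by rw [ha2]; exact hlm
    refine ⟨a, lt_of_le_of_ne ha1 ?_, hanti _ _ hlt⟩
    rintro rfl; exact lt_irrefl _ hlt
  obtain ⟨b, hjb, hcjb⟩ : ∃ b : Fin n, j < b ∧ c⁻¹ b < c⁻¹ j := by
    unfold rightmax at hrm
    obtain ⟨b, hb1, hb2⟩ := Finset.lt_sup_iff.1 hrm
    simp only [Finset.mem_filter, Finset.mem_univ, true_and] at hb1
    refine ⟨b, lt_of_le_of_ne hb1 ?_, hanti _ _ hb2⟩
    rintro rfl; exact lt_irrefl _ hb2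
  obtain ⟨z, hz1, hz2, hz3, hz4⟩ := cox_center c hc p j a b h2 hap hcap hjb hcjb
  simp only [Fin.lt_def] at h1 h2 h3
  have hqn := q.2
  have hpre := prefix_bound c lam hlam z (by omega) hz3 hz4
  have P1 := RowP_prefix N _ _ hαN (coeff_RowP N _ _ hαN ha) (z + 1)
  have P2 := RowP_prefix N _ _ hαN (coeff_RowP N _ _ hαN hb) (z + 1)
  have hR : RowP N (fun x => lam (c⁻¹ x)) (toNatV n β) := coeff_RowP N _ _ hαN hβ
  set Z := (Finset.univ : Finset (Fin n)).filter (fun y => y.1 < z + 1) with hZ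
  have cZ : Z.card = z + 1 := by rw [hZ, Fin.card_filter_val_lt]; omega
  have memZ : ∀ x, x ∈ Z ↔ x.1 < z + 1 := by intro x; simp [hZ]
  have FZ : ∀ s : Fin n → ℕ, FF s (z + 1) = ∑ x ∈ Z, s x := by
    intro s; unfold FF; rw [hZ, Finset.sum_filter]
  have hip : i ≠ p := by intro h; rw [h] at h1; omega
  have hjq : j ≠ q := by intro h; rw [h] at h3; omega
  have hiZ : i ∈ Z := by rw [memZ]; omega
  have hpZ : p ∈ Z := by rw [memZ]; omega
  have hjZ : j ∉ Z := by rw [memZ]; omega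
  have hqZ : q ∉ Z := by rw [memZ]; omega
  -- upper bounds
  have U1 := RowP_dom N lam _ c⁻¹ hlam hlN hR ((Z.erase i).erase p)
  have U2 := RowP_dom N lam _ c⁻¹ hlam hlN hR (insert j (insert q Z))
  have hpZi : p ∈ Z.erase i := Finset.mem_erase.2 ⟨hip.symm, hpZ⟩
  have hjZq : j ∉ insert q Z := by
    rw [Finset.mem_insert]; rintro (h | h)
    · exact hjq h
    · exact hjZ h
  rw [Finset.card_erase_of_mem hpZi, Finset.card_erase_of_mem hiZ, cZ] at U1
  rw [Finset.card_insert_of_notMem hjZq, Finset.card_insert_of_notMem hqZ, cZ,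
    Finset.sum_insert hjZq, Finset.sum_insert hqZ] at U2
  have E1 := Finset.add_sum_erase (Z.erase i) (toNatV n β) hpZi
  have E2 := Finset.add_sum_erase Z (toNatV n β) hiZ
  -- lambda sums
  have hz0 : 1 ≤ z := by omega
  have l1 := FF_succ lam (⟨z - 1, by omega⟩ : Fin n)
  have l2 := FF_succ lam (⟨z, by omega⟩ : Fin n)
  have l3 := FF_succ lam (⟨z + 1, by omega⟩ : Fin n)
  have l4 := FF_succ lam (⟨z + 2, by omega⟩ : Fin n)
  have m1 := hlam (⟨z - 1, by omega⟩ : Fin n) ⟨z, by omega⟩ (by rw [Fin.le_def]; simp)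
  have m2 := hlam (⟨z + 1, by omega⟩ : Fin n) ⟨z + 2, by omega⟩ (by rw [Fin.le_def]; simp)
  simp only [Nat.sub_add_cancel hz0, Nat.add_assoc, Nat.reduceAdd] at l1 l2 l3 l4 U1 U2
  rw [show z + 1 - 1 - 1 = z - 1 by omega] at U1
  -- prefix sums of the moved vectors
  have mv : ∀ u v : Fin n, u ∈ Z → v ∉ Z → (∀ x, 0 ≤ tmv n u v β x) →
      (FF (toNatV n (tmv n u v β)) (z + 1) : ℤ) =
      (∑ x ∈ Z, toNatV n β x : ℕ) - β u + (β v - gapZ n u v) := by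
    intro u v hu hv h0
    rw [FZ, ← Finset.add_sum_erase Z _ hu, ← Finset.add_sum_erase Z (toNatV n β) hu]
    have : ∑ x ∈ Z.erase u, toNatV n (tmv n u v β) x = ∑ x ∈ Z.erase u, toNatV n β x := by
      apply Finset.sum_congr rfl
      intro x hx
      have hx' := Finset.mem_erase.1 hx
      unfold toNatV tmv
      rw [if_neg hx'.1, if_neg (by rintro rfl; exact hv hx'.2)]
    rw [this]
    have g1 : (toNatV n (tmv n u v β) u : ℤ) = β v - gapZ n u v := by
      unfold toNatV
      rw [Int.toNat_of_nonneg (h0 u)]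
      simp [tmv]
    have g2 : (toNatV n β u : ℤ) = β u := by
      unfold toNatV; rw [Int.toNat_of_nonneg (hβ0 u)]
    push_cast
    rw [g1, g2]
    ring
  have M1 := mv i j hiZ hjZ ha0
  have M2 := mv p q hpZ hqZ hb0
  have tn : ∀ x, (toNatV n β x : ℤ) = β x := by
    intro x; unfold toNatV; rw [Int.toNat_of_nonneg (hβ0 x)]
  have ti := tn i
  have tp := tn p
  have tj := tn j
  have tq := tn q
  unfold gapZ at M1 M2
  have hpre' : FF lam z + lam ⟨z + 1, by omega⟩ ≤ FF (pact n c lam) (z + 1) := hpre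
  omega


/-- Lemma 6.10: if `i < p < j < q` lie in the same block, both `(i,j)`
and `(p,q)` are interweaved for `cλ`, and `β < t_{ij}β`, `β < t_{pq}β`, then at most one of
`t_{ij}β`, `t_{pq}β` lies in `P_{cλ,γ}`. -/
theorem stmt19 (n k : ℕ) (d : Fin (k + 2) → ℕ) (hd : BlockData n k d)
    (c w0I : Equiv.Perm (Fin n)) (hc : IsStdCox n c)
    (h0 : IsLongest n (Iset n k d) w0I)
    (hlen : len n (w0I * c) = len n w0I + len n c)
    (hJ : Iset n k d ⊆ Descents n (w0I * c))
    (lam : Fin n → ℕ) (hlam : IsPartition n lam)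
    (γ : Fin (k + 1) → ℕ → ℕ) (hγ : ParD k d γ)
    (β : Fin n → ℤ) (hβ : memP n k d w0I (pact n c lam) γ β)
    (i p j q : Fin n) (h1 : i < p) (h2 : p < j) (h3 : j < q)
    (hsb : SameBlock n k d i q)
    (hw1 : Interweaved n (pact n c lam) i j)
    (hw2 : Interweaved n (pact n c lam) p q)
    (hb1 : β j - gapZ n i j < β i)
    (hb2 : β q - gapZ n p q < β p) :
    ¬ memP n k d w0I (pact n c lam) γ (tmv n i j β) ∨
    ¬ memP n k d w0I (pact n c lam) γ (tmv n p q β) := by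
  by_contra hcon
  rw [not_or, not_not, not_not] at hcon
  obtain ⟨hA, hB⟩ := hcon
  exact main_aux c hc lam hlam β i p j q h1 h2 h3 hw2.2.2.1 hw1.2.2.2 hβ.1 hβ.2.1
    hA.1 hA.2.1 hB.1 hB.2.1

end LSS
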